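/- Fix an integer n ≥ 1, δ ∈ [0,1), and α ∈ (0,1). Let μ_0 and μ_1 be Borel probability measures on ℝ and set ν = (1−δ)·μ_0 + δ·μ_1. Let S_1, …, S_n be i.i.d. with law ν (contaminated calibration scores) and let S_{n+1} have law μ_0 (the null test score), all n+1 variables being mutually independent. Let p̂ = (1 + #{i ∈ {1,…,n} : S_i ≥ S_{n+1}})/(n+1) be the conformal p-value, let Q̂ be the ⌈(1−α)(n+1)⌉-th smallest element of the multiset {S_1, …, S_n} ∪ {+∞} in [−∞,+∞], and for j ∈ {0,1} let F_j : [−∞,+∞] → [0,1] be the CDF of μ_j, F_j(t) = μ_j((−∞, t]), with F_j(+∞) = 1. Then P(p̂ ≤ α) ≤ α − δ·E[F_0(Q̂) − F_1(Q̂)], where the expectation is over the calibration scores. -/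

import Mathlib

open MeasureTheory

/-- The `k`-th smallest element (1-indexed) of a finite multiset of extended reals,
i.e. the `k`-th entry when the elements are listed in nondecreasing order
(counted with multiplicity). -/
noncomputable def kthSmallestE (A : Multiset EReal) (k : ℕ) : EReal :=
  (A.sort (· ≤ ·)).getD (k - 1) 0

/-- The CDF of a Borel measure on `ℝ`, evaluated at an extended real `t`:
`F(t) = μ((−∞, t])`, with `F(+∞) = 1` (for a probability measure) and `F(−∞) = 0`. -/
noncomputable def cdfE (μ : Measure ℝ) (t : EReal) : ℝ :=
  (μ {x : ℝ | (x : EReal) ≤ t}).toReal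

/-- In a nondecreasing list, the entry of index `m` is below `t` iff more than `m` entries are. -/
theorem List.getElem_lt_iff_lt_countP {β : Type*} [LinearOrder β] (t : β) :
    ∀ (l : List β), l.Pairwise (· ≤ ·) → ∀ (m : ℕ) (hm : m < l.length),
      l[m] < t ↔ m < l.countP (fun x => decide (x < t))
  | [], _, m, hm => by simp at hm
  | a :: l, hl, m, hm => by
    rw [List.pairwise_cons] at hl
    by_cases ha : a < t
    · rw [List.countP_cons_of_pos (by simpa using ha)]
      cases m with
      | zero => simpa using ha
      | succ m =>
        simpa using List.getElem_lt_iff_lt_countP t l hl.2 m (by simpa using hm)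
    · have h0 : (a :: l).countP (fun x => decide (x < t)) = 0 := by
        rw [List.countP_eq_zero]
        intro b hb
        rcases List.mem_cons.1 hb with rfl | hb
        · simpa using ha
        · simpa using (not_lt.1 ha).trans (hl.1 b hb)
      rw [h0]
      have : ∀ b ∈ a :: l, ¬ b < t := by
        simpa [List.countP_eq_zero] using h0
      simpa using this _ (List.getElem_mem hm)

theorem kthSmallestE_lt_iff (A : Multiset EReal) {k : ℕ} (hk : 1 ≤ k) (hkA : k ≤ A.card)
    (t : EReal) : kthSmallestE A k < t ↔ k ≤ A.countP (· < t) := by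
  have hlen : k - 1 < (A.sort (· ≤ ·)).length := by
    rw [Multiset.length_sort]; omega
  have hcount : A.countP (· < t) = (A.sort (· ≤ ·)).countP (fun x => decide (x < t)) := by
    conv_lhs => rw [← Multiset.sort_eq A (· ≤ ·)]
    rw [Multiset.coe_countP]
  rw [kthSmallestE, List.getD_eq_getElem _ _ hlen,
    List.getElem_lt_iff_lt_countP t _ (A.pairwise_sort (· ≤ ·)), hcount]
  omega

theorem kthSmallestE_cons_top_lt_iff {n k : ℕ} (hk : 1 ≤ k) (hkn : k ≤ n + 1) (y : Fin n → ℝ)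
    (t : ℝ) :
    kthSmallestE ((⊤ : EReal) ::ₘ (Finset.univ.val.map fun i : Fin n => ((y i : ℝ) : EReal))) k < t
      ↔ k ≤ (Finset.univ.filter fun i => y i < t).card := by
  rw [kthSmallestE_lt_iff _ hk (by simpa using hkn), Multiset.countP_cons_of_neg _ (by simp),
    Multiset.countP_map]
  simp [Finset.card, Finset.filter_val]

theorem cdfE_kthSmallestE_cons_top {n k : ℕ} (hk : 1 ≤ k) (hkn : k ≤ n + 1) (y : Fin n → ℝ)
    (μ : Measure ℝ) [IsProbabilityMeasure μ] :
    cdfE μ (kthSmallestE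
        ((⊤ : EReal) ::ₘ (Finset.univ.val.map fun i : Fin n => ((y i : ℝ) : EReal))) k)
      = 1 - μ.real {t | k ≤ (Finset.univ.filter fun i => y i < t).card} := by
  set Q := kthSmallestE
    ((⊤ : EReal) ::ₘ (Finset.univ.val.map fun i : Fin n => ((y i : ℝ) : EReal))) k with hQ
  have hset : {t | k ≤ (Finset.univ.filter fun i => y i < t).card} = {x : ℝ | (x : EReal) ≤ Q}ᶜ := by
    ext t
    rw [Set.mem_compl_iff, Set.mem_ofPred_eq, Set.mem_ofPred_eq, not_le, hQ,
      kthSmallestE_cons_top_lt_iff hk hkn]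
  have hms : MeasurableSet {x : ℝ | (x : EReal) ≤ Q} :=
    measurableSet_le measurable_coe_real_ereal measurable_const
  rw [hset, probReal_compl_eq_one_sub hms, cdfE, Measure.real]
  ring

theorem card_filter_le_card_lt_add_le {ι : Type*} [Fintype ι] (x : ι → ℝ) {k : ℕ}
    (hk : k ≤ Fintype.card ι) :
    (Finset.univ.filter fun j => k ≤ (Finset.univ.filter fun i => x i < x j).card).card + k
      ≤ Fintype.card ι := by
  classical
  set J := Finset.univ.filter fun j => k ≤ (Finset.univ.filter fun i => x i < x j).card with hJ
  rcases J.eq_empty_or_nonempty with h | h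
  · simpa [h] using hk
  · obtain ⟨j, hj, hmin⟩ := J.exists_min_image x h
    have hdisj : Disjoint J (Finset.univ.filter fun i => x i < x j) := by
      rw [Finset.disjoint_left]
      intro i hi hi'
      exact absurd (hmin i hi) (not_le.2 (Finset.mem_filter.1 hi').2)
    calc J.card + k ≤ J.card + (Finset.univ.filter fun i => x i < x j).card := by
          gcongr; exact (Finset.mem_filter.1 hj).2
      _ = (J ∪ Finset.univ.filter fun i => x i < x j).card :=
          (Finset.card_union_of_disjoint hdisj).symm
      _ ≤ Fintype.card ι := Finset.card_le_univ _

theorem measurableSet_le_card_filter_lt {X ι : Type*} [MeasurableSpace X] [Fintype ι]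
    {f : ι → X → ℝ} {g : X → ℝ} (hf : ∀ i, Measurable (f i)) (hg : Measurable g) (k : ℕ) :
    MeasurableSet {x | k ≤ (Finset.univ.filter fun i => f i x < g x).card} := by
  have : Measurable fun x => (Finset.univ.filter fun i => f i x < g x).card := by
    simp_rw [Finset.card_filter]
    exact Finset.measurable_sum _ fun i _ =>
      Measurable.ite (measurableSet_lt (hf i) hg) measurable_const measurable_const
  exact measurableSet_le measurable_const this

/-- Among exchangeable coordinates, the chance that a given one exceeds at least `k` others. -/
theorem card_mul_pi_real_le {ι : Type*} [Fintype ι] (ν : Measure ℝ)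
    [IsProbabilityMeasure ν] {k : ℕ} (hk : k ≤ Fintype.card ι) (j₀ : ι) :
    Fintype.card ι * (Measure.pi fun _ : ι => ν).real
        {x | k ≤ (Finset.univ.filter fun i => x i < x j₀).card}
      ≤ Fintype.card ι - k := by
  classical
  set π := Measure.pi fun _ : ι => ν
  set E : ι → Set (ι → ℝ) := fun j => {x | k ≤ (Finset.univ.filter fun i => x i < x j).card}
  have hE : ∀ j, MeasurableSet (E j) := fun j =>
    measurableSet_le_card_filter_lt (fun i => measurable_pi_apply i) (measurable_pi_apply j) k
  have hperm : ∀ j, π.real (E j) = π.real (E j₀) := by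
    intro j
    have hmp := measurePreserving_arrowCongr' (fun _ : ι => ν) (fun _ : ι => ν) (Equiv.swap j j₀)
      (MeasurableEquiv.refl ℝ) (fun _ => MeasurePreserving.id ν)
    rw [← hmp.measureReal_preimage (hE j₀).nullMeasurableSet]
    congr 1
    ext x
    have hcard : (Finset.univ.filter fun i => x (Equiv.swap j j₀ i) < x j).card
        = (Finset.univ.filter fun i => x i < x j).card :=
      Finset.card_equiv (Equiv.swap j j₀) (by simp)
    change k ≤ _ ↔ k ≤ (Finset.univ.filter fun i =>
      x (Equiv.swap j j₀ i) < x (Equiv.swap j j₀ j₀)).card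
    rw [Equiv.swap_apply_right, hcard]
  have hsum : ∑ j, π.real (E j) ≤ (Fintype.card ι : ℝ) - k := by
    have hint : ∀ j ∈ Finset.univ, Integrable ((E j).indicator (1 : (ι → ℝ) → ℝ)) π := fun j _ =>
      (integrable_const (1 : ℝ)).indicator (hE j)
    calc ∑ j, π.real (E j) = ∑ j, ∫ x, (E j).indicator (1 : (ι → ℝ) → ℝ) x ∂π := by
          simp_rw [integral_indicator_one (hE _)]
      _ = ∫ x, ∑ j, (E j).indicator (1 : (ι → ℝ) → ℝ) x ∂π := (integral_finsetSum _ hint).symm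
      _ ≤ ∫ _, ((Fintype.card ι : ℝ) - k) ∂π := by
          refine integral_mono (integrable_finsetSum _ hint) (integrable_const _) fun x => ?_
          have h := card_filter_le_card_lt_add_le x hk
          have h' : ∑ j, (E j).indicator (1 : (ι → ℝ) → ℝ) x
              = ((Finset.univ.filter fun j =>
                  k ≤ (Finset.univ.filter fun i => x i < x j).card).card : ℝ) := by
            simp [Set.indicator_apply, E]
          simp only [h']
          rw [le_sub_iff_add_le]
          exact_mod_cast h
      _ = (Fintype.card ι : ℝ) - k := by simp
  simpa [hperm] using hsum

theorem measurePreserving_last_castSucc {n : ℕ} (μ : Fin (n + 1) → Measure ℝ)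
    [∀ i, SigmaFinite (μ i)] :
    MeasurePreserving (fun x : Fin (n + 1) → ℝ => (x (Fin.last n), fun i : Fin n => x i.castSucc))
      (Measure.pi μ) ((μ (Fin.last n)).prod (Measure.pi fun i : Fin n => μ i.castSucc)) := by
  have h := measurePreserving_piFinSuccAbove μ (Fin.last n)
  simp only [Fin.succAbove_last] at h
  convert h using 1
  ext x <;> simp [MeasurableEquiv.piFinSuccAbove, Fin.init]

/-- Conservativeness of the rank test for i.i.d. scores. -/
theorem prod_pi_real_le {n k : ℕ} (hkn : k ≤ n + 1) (ν : Measure ℝ) [IsProbabilityMeasure ν] :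
    (n + 1) * (ν.prod (Measure.pi fun _ : Fin n => ν)).real
        {p | k ≤ (Finset.univ.filter fun i => p.2 i < p.1).card} ≤ n + 1 - k := by
  have hA : MeasurableSet {p : ℝ × (Fin n → ℝ) |
      k ≤ (Finset.univ.filter fun i => p.2 i < p.1).card} :=
    measurableSet_le_card_filter_lt (f := fun i (p : ℝ × (Fin n → ℝ)) => p.2 i)
      (fun i => (measurable_pi_apply i).comp measurable_snd) measurable_fst k
  rw [← (measurePreserving_last_castSucc fun _ : Fin (n + 1) => ν).measureReal_preimage
    hA.nullMeasurableSet]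
  have h := card_mul_pi_real_le ν (ι := Fin (n + 1)) (k := k) (by simpa using hkn) (Fin.last n)
  have hcard : ∀ x : Fin (n + 1) → ℝ,
      (Finset.univ.filter fun i => x i < x (Fin.last n)).card
        = (Finset.univ.filter fun i : Fin n => x i.castSucc < x (Fin.last n)).card := by
    intro x
    rw [Finset.card_filter, Finset.card_filter, Fin.sum_univ_castSucc]
    simp only [lt_irrefl, if_false, add_zero]
  simpa [hcard] using h

theorem prod_real_eq_integral {X Y : Type*} [MeasurableSpace X] [MeasurableSpace Y]
    (μ : Measure X) (ν : Measure Y) [IsFiniteMeasure μ] [IsFiniteMeasure ν]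
    {A : Set (X × Y)} (hA : MeasurableSet A) :
    (μ.prod ν).real A = ∫ y, μ.real {x | (x, y) ∈ A} ∂ν := by
  rw [Measure.real, Measure.prod_apply_symm hA, ← integral_toReal
    (measurable_measure_prodMk_right hA).aemeasurable (by simp)]
  rfl

theorem conformal_pvalue_le_iff {n : ℕ} (α t : ℝ) (y : Fin n → ℝ) :
    (1 + ((Finset.univ.filter fun i : Fin n => t ≤ y i).card : ℝ)) / (n + 1) ≤ α
      ↔ ⌈(1 - α) * (n + 1)⌉₊ ≤ (Finset.univ.filter fun i => y i < t).card := by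
  have h : ((Finset.univ.filter fun i : Fin n => y i < t).card : ℝ)
      + (Finset.univ.filter fun i : Fin n => t ≤ y i).card = n := by
    have := Finset.card_filter_add_card_filter_not (s := Finset.univ) fun i : Fin n => y i < t
    simp only [not_lt, Finset.card_univ, Fintype.card_fin] at this
    exact_mod_cast this
  rw [Nat.ceil_le, div_le_iff₀ (by positivity)]
  constructor <;> intro <;> linarith

/-- (Corollary A.3: conservativeness of conformal p-values when
the calibration scores are i.i.d. from the mixture `(1−δ)·μ0 + δ·μ1` of the
inlier and outlier distributions and the test score has the inlier law `μ0`).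
With `Q̂` the `⌈(1−α)(n+1)⌉`-th smallest element of the calibration scores
together with `+∞`, `P(p̂ ≤ α) ≤ α − δ·E[F₀(Q̂) − F₁(Q̂)]`. -/
theorem mixture_conformal_conservative
    {Ω : Type*} [MeasurableSpace Ω] (P : Measure Ω) [IsProbabilityMeasure P]
    (n : ℕ) (hn : 1 ≤ n) (δ : ℝ) (hδ : δ ∈ Set.Ico (0 : ℝ) 1)
    (μ0 μ1 : Measure ℝ) [IsProbabilityMeasure μ0] [IsProbabilityMeasure μ1]
    (S : Fin (n + 1) → Ω → ℝ)
    (hmeas : ∀ i, Measurable (S i))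
    (hlaw : Measure.map (fun ω i => S i ω) P
      = Measure.pi fun i : Fin (n + 1) =>
          if i.val < n then ENNReal.ofReal (1 - δ) • μ0 + ENNReal.ofReal δ • μ1 else μ0)
    (α : ℝ) (hα : α ∈ Set.Ioo (0 : ℝ) 1) :
    (P {ω | (1 + ((Finset.univ.filter
          fun i : Fin n => S (Fin.last n) ω ≤ S i.castSucc ω).card : ℝ)) / (n + 1) ≤ α}).toReal
      ≤ α - δ *
          ∫ ω, (cdfE μ0 (kthSmallestE
                ((⊤ : EReal) ::ₘ (Finset.univ.val.map
                  fun i : Fin n => ((S i.castSucc ω : ℝ) : EReal)))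
                ⌈(1 - α) * (n + 1)⌉₊)
              - cdfE μ1 (kthSmallestE
                ((⊤ : EReal) ::ₘ (Finset.univ.val.map
                  fun i : Fin n => ((S i.castSucc ω : ℝ) : EReal)))
                ⌈(1 - α) * (n + 1)⌉₊)) ∂P := by
  set k := ⌈(1 - α) * (n + 1)⌉₊ with hk_def
  have hk : 1 ≤ k := Nat.one_le_ceil_iff.2 (mul_pos (by linarith [hα.2]) (by positivity))
  have hkn : k ≤ n + 1 := by
    rw [hk_def, Nat.ceil_le]
    push_cast
    nlinarith [hα.1]
  have hδ0 : 0 ≤ δ := hδ.1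
  have hδ1 : 0 ≤ 1 - δ := by linarith [hδ.2]
  set ν := ENNReal.ofReal (1 - δ) • μ0 + ENNReal.ofReal δ • μ1 with hν
  have : IsProbabilityMeasure ν := ⟨by
    simp [hν, ← ENNReal.ofReal_add hδ1 hδ0]⟩
  have hν_real (s : Set ℝ) : ν.real s = (1 - δ) * μ0.real s + δ * μ1.real s := by
    rw [hν, measureReal_add_apply (ENNReal.mul_ne_top ENNReal.ofReal_ne_top (measure_ne_top _ _))
      (ENNReal.mul_ne_top ENNReal.ofReal_ne_top (measure_ne_top _ _))]
    simp [ENNReal.toReal_ofReal, hδ0, hδ1]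
  set π := Measure.pi fun _ : Fin n => ν
  set A : Set (ℝ × (Fin n → ℝ)) := {p | k ≤ (Finset.univ.filter fun i => p.2 i < p.1).card}
  have hA : MeasurableSet A :=
    measurableSet_le_card_filter_lt (f := fun i (p : ℝ × (Fin n → ℝ)) => p.2 i)
      (fun i => (measurable_pi_apply i).comp measurable_snd) measurable_fst k
  have hjoint : MeasurePreserving (fun ω => (S (Fin.last n) ω, fun i : Fin n => S i.castSucc ω))
      P (μ0.prod π) := by
    have (i : Fin (n + 1)) : SigmaFinite (if i.val < n then ν else μ0) := by
      split_ifs <;> infer_instance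
    have h := (measurePreserving_last_castSucc
      fun i : Fin (n + 1) => if i.val < n then ν else μ0).comp
        ⟨measurable_pi_lambda _ hmeas, hlaw⟩
    simpa [Function.comp_def] using h
  have hcal : MeasurePreserving (fun ω (i : Fin n) => S i.castSucc ω) P π :=
    measurePreserving_snd.comp hjoint
  have hG_meas (μ : Measure ℝ) [IsProbabilityMeasure μ] :
      Measurable fun y => μ.real {t | (t, y) ∈ A} :=
    (measurable_measure_prodMk_right hA).ennreal_toReal
  have hG_int (μ : Measure ℝ) [IsProbabilityMeasure μ] :
      Integrable (fun y => μ.real {t | (t, y) ∈ A}) π :=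
    Integrable.of_bound (hG_meas μ).aestronglyMeasurable 1 (ae_of_all _ fun y => by
      rw [Real.norm_of_nonneg measureReal_nonneg]
      exact measureReal_le_one)
  have hp : (P {ω | (1 + ((Finset.univ.filter
      fun i : Fin n => S (Fin.last n) ω ≤ S i.castSucc ω).card : ℝ)) / (n + 1) ≤ α}).toReal
      = ∫ y, μ0.real {t | (t, y) ∈ A} ∂π := by
    rw [← prod_real_eq_integral μ0 π hA, ← hjoint.measureReal_preimage hA.nullMeasurableSet,
      Measure.real]
    simp only [conformal_pvalue_le_iff α]
    rfl
  have hmix : (1 - δ) * ∫ y, μ0.real {t | (t, y) ∈ A} ∂π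
      + δ * ∫ y, μ1.real {t | (t, y) ∈ A} ∂π ≤ α := by
    have h := prod_pi_real_le hkn ν
    rw [prod_real_eq_integral ν π hA] at h
    simp only [hν_real] at h
    rw [integral_add ((hG_int μ0).const_mul _) ((hG_int μ1).const_mul _),
      integral_const_mul, integral_const_mul] at h
    have hceil : (1 - α) * (n + 1) ≤ k := Nat.le_ceil _
    refine le_of_mul_le_mul_left (h.trans ?_) (by positivity : (0 : ℝ) < n + 1)
    linarith
  have hQ : ∫ ω, (cdfE μ0 (kthSmallestE
                ((⊤ : EReal) ::ₘ (Finset.univ.val.map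
                  fun i : Fin n => ((S i.castSucc ω : ℝ) : EReal))) k)
              - cdfE μ1 (kthSmallestE
                ((⊤ : EReal) ::ₘ (Finset.univ.val.map
                  fun i : Fin n => ((S i.castSucc ω : ℝ) : EReal))) k)) ∂P
      = ∫ y, μ1.real {t | (t, y) ∈ A} ∂π - ∫ y, μ0.real {t | (t, y) ∈ A} ∂π := by
    rw [← integral_sub (hG_int μ1) (hG_int μ0), ← hcal.map_eq, integral_map
      hcal.measurable.aemeasurable (by
        exact ((hG_meas μ1).sub (hG_meas μ0)).aestronglyMeasurable)]
    refine integral_congr_ae (ae_of_all _ fun ω => ?_)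
    simp only [cdfE_kthSmallestE_cons_top hk hkn fun i => S i.castSucc ω]
    simp only [A, Set.mem_ofPred_eq]
    ring
  rw [hp, hQ]
  linarith
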